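/- Burnside's theorem on abelian normal subgroups: a group of order ℓⁿ (ℓ prime) whose center has order ℓᶜ contains a normal abelian subgroup of order ℓ^ν with ν ≥ −1/2 + √(2n + c² − c + 1/4). In particular, any group of order ℓ³ or ℓ⁴ contains a normal abelian subgroup of index ℓ. -/

import Mathlib

/-- A nontrivial normal subgroup of a finite `p`-group meets the center nontrivially. -/
theorem IsPGroup.exists_mem_center_of_normal {p : ℕ} [Fact p.Prime] {G : Type*} [Group G]
    [Finite G] (hG : IsPGroup p G) (N : Subgroup G) [N.Normal] (hN : N ≠ ⊥) :
    ∃ x ∈ N, x ≠ 1 ∧ x ∈ Subgroup.center G := by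
  have hp : p ∣ Nat.card N := by
    have : Nontrivial N := N.nontrivial_iff_ne_bot.mpr hN
    obtain ⟨k, hk, hcard⟩ := (hG.to_subgroup N).nontrivial_iff_card.mp inferInstance
    exact hcard ▸ dvd_pow_self p hk.ne'
  have hone : (1 : N) ∈ MulAction.fixedPoints (ConjAct G) N := fun g => smul_one g
  obtain ⟨x, hx, hx1⟩ := (hG.of_equiv
    ConjAct.toConjAct).exists_fixed_point_of_prime_dvd_card_of_fixed_point N hp hone
  refine ⟨x, x.2, fun h => hx1 (Subtype.ext h.symm), Subgroup.mem_center_iff.mpr fun g => ?_⟩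
  have h := congrArg Subtype.val (hx (ConjAct.toConjAct g))
  rw [ConjAct.Subgroup.val_conj_smul, ConjAct.toConjAct_smul] at h
  exact mul_inv_eq_iff_eq_mul.mp h

/-- If `B < N` are normal subgroups of a finite `p`-group, then `N` has an element outside `B`
that is central modulo `B`. -/
theorem IsPGroup.exists_mem_commutator_mem {p : ℕ} [Fact p.Prime] {G : Type*} [Group G]
    [Finite G] (hG : IsPGroup p G) (B N : Subgroup G) [B.Normal] [N.Normal] (hN : ¬ N ≤ B) :
    ∃ x ∈ N, x ∉ B ∧ ∀ g : G, g * x * g⁻¹ * x⁻¹ ∈ B := by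
  have : (N.map (QuotientGroup.mk' B)).Normal :=
    Subgroup.Normal.map inferInstance _ (QuotientGroup.mk'_surjective B)
  obtain ⟨_, ⟨x, hxN, rfl⟩, hx1, hxc⟩ := (hG.to_quotient B).exists_mem_center_of_normal
    (N.map (QuotientGroup.mk' B)) (by rwa [Ne, Subgroup.map_eq_bot_iff, QuotientGroup.ker_mk'])
  refine ⟨x, hxN, fun h => hx1 ((QuotientGroup.eq_one_iff x).mpr h), fun g => ?_⟩
  have h := Subgroup.mem_center_iff.mp hxc (QuotientGroup.mk' B g)
  rw [← QuotientGroup.ker_mk' B, MonoidHom.mem_ker]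
  simp only [map_mul, map_inv, h]
  group

/-- If `x` is central modulo `B`, then it has at most `|B|` conjugates. -/
theorem Subgroup.index_centralizer_singleton_le {G : Type*} [Group G] [Finite G]
    (B : Subgroup G) (x : G) (hx : ∀ g : G, g * x * g⁻¹ * x⁻¹ ∈ B) :
    (Subgroup.centralizer {x}).index ≤ Nat.card B := by
  refine Nat.card_le_card_of_injective (fun q : G ⧸ Subgroup.centralizer {x} =>
    (⟨q.out * x * q.out⁻¹ * x⁻¹, hx _⟩ : B)) fun q r h => ?_
  have h' := mul_right_cancel (congrArg Subtype.val h)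
  rw [← q.out_eq', ← r.out_eq']
  refine QuotientGroup.eq.mpr (Subgroup.mem_centralizer_singleton_iff.mpr ?_)
  have h₂ := congrArg (fun y => q.out⁻¹ * y * r.out) h'
  simpa [mul_assoc] using h₂.symm

/-- Adjoining to `B` an element central modulo `B` shrinks the centralizer by a factor of at
most `|B|`. -/
theorem Subgroup.card_centralizer_le_mul {G : Type*} [Group G] [Finite G]
    (B : Subgroup G) (x : G) (hx : ∀ g : G, g * x * g⁻¹ * x⁻¹ ∈ B) :
    Nat.card (centralizer (B : Set G)) ≤
      Nat.card (centralizer ((B ⊔ zpowers x : Subgroup G) : Set G)) * Nat.card B := by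
  have hle : centralizer (B : Set G) ⊓ centralizer {x} ≤
      centralizer ((B ⊔ zpowers x : Subgroup G) : Set G) := by
    rw [le_centralizer_iff, sup_le_iff, zpowers_le]
    exact ⟨le_centralizer_iff.mp inf_le_left,
      mem_centralizer_iff.mpr fun g hg => (mem_centralizer_singleton_iff.mp hg.2)⟩
  calc Nat.card (centralizer (B : Set G))
      = Nat.card (centralizer (B : Set G) ⊓ centralizer {x} : Subgroup G) *
          (centralizer (B : Set G) ⊓ centralizer {x}).relIndex (centralizer (B : Set G)) := by
        simpa only [relIndex_bot_left] using
          (relIndex_mul_relIndex ⊥ _ (centralizer (B : Set G)) bot_le inf_le_left).symm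
    _ ≤ _ := by
      refine Nat.mul_le_mul (Subgroup.card_le_of_le hle) ?_
      rw [inf_relIndex_left]
      refine (relIndex_le_of_le_right le_top ?_).trans
        ((relIndex_top_right _).trans_le (B.index_centralizer_singleton_le x hx))
      rw [relIndex_top_right]
      exact index_ne_zero_of_finite

/-- Burnside bound: some abelian normal subgroup of order `p ^ a` of a finite `p`-group with
center of order `p ^ c` satisfies `|G| ≤ p ^ (a + a (a - 1) / 2 - c (c - 1) / 2)`. -/
theorem IsPGroup.exists_normal_comm_card {p : ℕ} [Fact p.Prime] {G : Type*} [Group G]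
    [Finite G] (hG : IsPGroup p G) {c : ℕ} (hc : Nat.card (Subgroup.center G) = p ^ c) :
    ∃ A : Subgroup G, A.Normal ∧ A ≤ Subgroup.centralizer (A : Set G) ∧
      ∃ a, Nat.card A = p ^ a ∧ Nat.card G * p ^ c.choose 2 ≤ p ^ (a + a.choose 2) := by
  have hp : p.Prime := Fact.out
  let S : Set (Subgroup G) := {B | B.Normal ∧ B ≤ Subgroup.centralizer (B : Set G) ∧
    ∃ b, Nat.card B = p ^ b ∧ Nat.card G * p ^ c.choose 2 ≤
      Nat.card (Subgroup.centralizer (B : Set G)) * p ^ b.choose 2}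
  have hS : Subgroup.center G ∈ S := by
    have htop : Subgroup.centralizer (Subgroup.center G : Set G) = ⊤ :=
      Subgroup.centralizer_eq_top_iff_subset.mpr le_rfl
    exact ⟨inferInstance, by rw [htop]; exact le_top, c, hc,
      by rw [htop, Subgroup.card_top]⟩
  obtain ⟨B, ⟨hBn, hBc, b, hb, hle⟩, hmax⟩ := S.toFinite.exists_maximal ⟨_, hS⟩
  refine ⟨B, hBn, hBc, b, hb, ?_⟩
  suffices h : Subgroup.centralizer (B : Set G) ≤ B by
    rwa [le_antisymm h hBc, hb, ← pow_add] at hle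
  by_contra hN
  obtain ⟨x, hxC, hxB, hx⟩ := hG.exists_mem_commutator_mem B _ hN
  set B' := B ⊔ Subgroup.zpowers x
  have hxB' : x ∈ B' := Subgroup.mem_sup_right (Subgroup.mem_zpowers x)
  have hBB' : B ≤ B' := le_sup_left
  refine hxB (hmax (y := B') ⟨?_, ?_, ?_⟩ hBB' hxB')
  · refine Subgroup.normalizer_eq_top_iff.mp (top_le_iff.mp fun g _ => ?_)
    have hconj : ∀ g : G, B' ≤ B'.comap (MulAut.conj g).toMonoidHom := by
      intro g
      refine sup_le (fun y hy => hBB' (hBn.conj_mem y hy g)) ?_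
      rw [Subgroup.zpowers_le]
      change g * x * g⁻¹ ∈ B'
      simpa using mul_mem (hBB' (hx g)) hxB'
    refine Subgroup.mem_normalizer_iff.mpr fun y => ⟨fun hy => hconj g hy, fun hy => ?_⟩
    simpa [mul_assoc] using hconj g⁻¹ hy
  · have hxc : B ≤ Subgroup.centralizer {x} := fun y hy =>
      Subgroup.mem_centralizer_singleton_iff.mpr (Subgroup.mem_centralizer_iff.mp hxC y hy)
    have hB'B : B' ≤ Subgroup.centralizer (B : Set G) :=
      sup_le hBc ((Subgroup.zpowers_le).mpr hxC)
    refine sup_le (Subgroup.le_centralizer_iff.mp hB'B) ((Subgroup.zpowers_le).mpr ?_)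
    have : B' ≤ Subgroup.centralizer {x} := sup_le hxc
      ((Subgroup.zpowers_le).mpr (Subgroup.mem_centralizer_singleton_iff.mpr rfl))
    exact Subgroup.mem_centralizer_iff.mpr fun y hy =>
      Subgroup.mem_centralizer_singleton_iff.mp (this hy)
  · obtain ⟨b', hb'⟩ := (IsPGroup.iff_card).mp (hG.to_subgroup B')
    have hlt : b < b' := by
      refine (Nat.pow_lt_pow_iff_right hp.one_lt).mp ?_
      rw [← hb, ← hb']
      exact Set.ncard_lt_ncard (Set.ssubset_iff_exists.mpr ⟨hBB', x, hxB', hxB⟩)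
    refine ⟨b', hb', hle.trans ?_⟩
    calc _ ≤ Nat.card (Subgroup.centralizer (B' : Set G)) * Nat.card B * p ^ b.choose 2 :=
          Nat.mul_le_mul_right _ (B.card_centralizer_le_mul x hx)
      _ = Nat.card (Subgroup.centralizer (B' : Set G)) * p ^ (b + 1).choose 2 := by
          rw [hb, mul_assoc, ← pow_add, Nat.choose_succ_succ' b 1, Nat.choose_one_right]
      _ ≤ _ := Nat.mul_le_mul_left _ (Nat.pow_le_pow_right hp.pos (Nat.choose_le_choose 2 hlt))

theorem stmt12 {G : Type*} [Group G] [Finite G] (ℓ n c : ℕ) (hℓ : ℓ.Prime)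
    (hG : Nat.card G = ℓ ^ n) (hc : Nat.card (Subgroup.center G) = ℓ ^ c) :
    (∃ A : Subgroup G, A.Normal ∧ (∀ x ∈ A, ∀ y ∈ A, x * y = y * x) ∧
      ∃ ν : ℕ, Nat.card A = ℓ ^ ν ∧
        (-(1 / 2 : ℝ) + Real.sqrt (2 * n + c ^ 2 - c + 1 / 4) ≤ (ν : ℝ))) ∧
    (n = 3 ∨ n = 4 →
      ∃ A : Subgroup G, A.Normal ∧ (∀ x ∈ A, ∀ y ∈ A, x * y = y * x) ∧ A.index = ℓ) := by
  have : Fact ℓ.Prime := ⟨hℓ⟩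
  obtain ⟨A, hAn, hAc, a, ha, hle⟩ := (IsPGroup.of_card hG).exists_normal_comm_card hc
  have hcomm : ∀ x ∈ A, ∀ y ∈ A, x * y = y * x := fun x hx y hy =>
    Subgroup.mem_centralizer_iff.mp (hAc hy) x hx
  rw [hG, ← pow_add] at hle
  have hexp : n + c.choose 2 ≤ a + a.choose 2 := (Nat.pow_le_pow_iff_right hℓ.one_lt).mp hle
  constructor
  · refine ⟨A, hAn, hcomm, a, ha, ?_⟩
    have h : (n : ℝ) + (c.choose 2 : ℕ) ≤ a + (a.choose 2 : ℕ) := by exact_mod_cast hexp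
    rw [Nat.cast_choose_two, Nat.cast_choose_two] at h
    have : Real.sqrt (2 * n + c ^ 2 - c + 1 / 4) ≤ a + 1 / 2 :=
      Real.sqrt_le_iff.mpr ⟨by positivity, by nlinarith⟩
    linarith
  · intro hn
    have han : a ≤ n := (Nat.pow_le_pow_iff_right hℓ.one_lt).mp
      (ha ▸ hG ▸ Subgroup.card_le_card_group A)
    have hna : n ≤ a + 1 := by
      by_contra! hlt
      have : a ≤ 2 := by omega
      interval_cases a <;> simp at hexp <;> omega
    have index_eq : ∀ H : Subgroup G, Nat.card H = ℓ ^ (n - 1) → H.index = ℓ := by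
      intro H hH
      have h := H.card_mul_index
      rw [hH, hG, show n = n - 1 + 1 by omega, Nat.add_sub_cancel, pow_succ] at h
      exact Nat.eq_of_mul_eq_mul_left (pow_pos hℓ.pos _) h
    rcases han.eq_or_lt with rfl | hlt
    · have hA : A = ⊤ := Subgroup.eq_top_of_card_eq A (ha.trans hG.symm)
      obtain ⟨H, hH⟩ := Sylow.exists_subgroup_card_pow_prime (G := G) ℓ (n := a - 1)
        (hG ▸ pow_dvd_pow ℓ (Nat.sub_le _ _))
      have hcomm' : ∀ x y : G, x * y = y * x := fun x y =>
        hcomm x (hA ▸ Subgroup.mem_top x) y (hA ▸ Subgroup.mem_top y)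
      refine ⟨H, ⟨fun y hy g => ?_⟩, fun x _ y _ => hcomm' x y, index_eq H hH⟩
      rwa [hcomm' g y, mul_inv_cancel_right]
    · exact ⟨A, hAn, hcomm, index_eq A (by rw [ha]; congr 1; omega)⟩
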